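/- Let X be the set of functions u : ℝ → ℝ with u' ∈ BV_loc(ℝ, {±1}) and set f^ω_{R,m}(u) = (1/R)( A₀ ‖u'‖_{BV(−R/2,R/2)} + m ∫_{−R/2}^{R/2} a(ω,t) u(t)² dt ), where 1 ≤ a ≤ 2. Then there exists η > 0, depending only on α, β and A₀ and independent of R > 1, of m satisfying 0 < α ≤ m ≤ β, and of ω, such that for any minimizer u of f^ω_{R,m} over X, the distance between any two consecutive jump points of u' in (−R/2, R/2) is at least η. -/

import Mathlib

open Filter Topology MeasureTheory Metric ENNReal

noncomputable section

/-- A sawtooth function on `ℝ`: `u` is the integral of a `±1`-valued function `g` of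
locally bounded variation, i.e. `u' ∈ BV_loc(ℝ, ±1)`. -/
def SawtoothLoc (u g : ℝ → ℝ) : Prop :=
  (∀ t, g t = 1 ∨ g t = -1) ∧
  (∀ s₁ s₂ : ℝ, u s₂ = u s₁ + ∫ t in s₁..s₂, g t) ∧
  ∀ b₁ b₂ : ℝ, eVariationOn g (Set.Icc b₁ b₂) < ∞

/-- The sharp interface functional
`f^ω_{R,m}(u) = (1/R)(A₀‖u'‖_{BV(-R/2,R/2)} + m ∫_{-R/2}^{R/2} a(t) u(t)² dt)`,
evaluated on a sawtooth function `u` with derivative representative `g`. -/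
def fRm (A₀ : ℝ) (a : ℝ → ℝ) (R mval : ℝ) (u g : ℝ → ℝ) : ℝ≥0∞ :=
  ENNReal.ofReal R⁻¹ *
    (ENNReal.ofReal A₀ * eVariationOn g (Set.Ioo (-(R / 2)) (R / 2)) +
      ENNReal.ofReal mval *
        ∫⁻ t in Set.Ioo (-(R / 2)) (R / 2), ENNReal.ofReal (a t * u t ^ 2))

lemma MonotoneOn.eVariationOn_le_two {f : ℝ → ℝ} {s : Set ℝ}
    (hf : MonotoneOn f s) (h : ∀ x ∈ s, f x = 1 ∨ f x = -1) : eVariationOn f s ≤ 2 := by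
  rw [eVariationOn.eq_biSup_inter_Icc]
  simp only [Set.mem_ofPred_eq, iSup_le_iff, and_imp, Prod.forall]
  intro x y hx hy _
  rw [hf.eVariationOn_eq hx hy, show (2 : ℝ≥0∞) = ENNReal.ofReal 2 by simp]
  apply ENNReal.ofReal_le_ofReal
  rcases h x hx with h1 | h1 <;> rcases h y hy with h2 | h2 <;> linarith

lemma eVariationOn_neg (f : ℝ → ℝ) (s : Set ℝ) :
    eVariationOn (fun x => -f x) s = eVariationOn f s := by
  simp only [eVariationOn, edist_neg_neg]

lemma AntitoneOn.eVariationOn_le_two {f : ℝ → ℝ} {s : Set ℝ}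
    (hf : AntitoneOn f s) (h : ∀ x ∈ s, f x = 1 ∨ f x = -1) : eVariationOn f s ≤ 2 := by
  rw [← eVariationOn_neg]
  refine MonotoneOn.eVariationOn_le_two (fun x hx y hy hxy => neg_le_neg (hf hx hy hxy)) ?_
  intro x hx
  rcases h x hx with h1 | h1 <;> simp [h1]

lemma eVariationOn_cut (f : ℝ → ℝ) {s : Set ℝ} {p : ℝ} (hp : p ∈ s) :
    eVariationOn f s = eVariationOn f (s ∩ Set.Iic p) + eVariationOn f (s ∩ Set.Ici p) := by
  have h : s = s ∩ Set.Iic p ∪ s ∩ Set.Ici p := by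
    rw [← Set.inter_union_distrib_left, Set.Iic_union_Ici, Set.inter_univ]
  conv_lhs => rw [h]
  exact eVariationOn.union f ⟨⟨hp, Set.mem_Iic.2 le_rfl⟩, fun x hx => hx.2⟩
    ⟨⟨hp, Set.mem_Ici.2 le_rfl⟩, fun x hx => hx.2⟩

/-- Two sign changes of a `±1`-valued function contribute at least `4` to its variation. -/
lemma four_le_eVariationOn {g : ℝ → ℝ} {s : Set ℝ} {σ p x₁ x₂ : ℝ} (hσ : σ = 1 ∨ σ = -1)
    (hp : p ∈ s) (h₁ : x₁ ∈ s) (h₂ : x₂ ∈ s) (hp₁ : p ≤ x₁) (h₁₂ : x₁ ≤ x₂)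
    (gp : g p = σ) (g₁ : g x₁ = -σ) (g₂ : g x₂ = σ) : 4 ≤ eVariationOn g s := by
  have e : edist σ (-σ) = 2 := by
    rcases hσ with rfl | rfl <;> rw [edist_dist, Real.dist_eq] <;> norm_num
  rw [eVariationOn_cut g h₁]
  have A := eVariationOn.edist_le g (s := s ∩ Set.Iic x₁) ⟨hp, hp₁⟩ ⟨h₁, Set.mem_Iic.2 le_rfl⟩
  have B := eVariationOn.edist_le g (s := s ∩ Set.Ici x₁) ⟨h₂, h₁₂⟩ ⟨h₁, Set.mem_Ici.2 le_rfl⟩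
  rw [gp, g₁, e] at A
  rw [g₂, g₁, e] at B
  calc (4 : ℝ≥0∞) = 2 + 2 := by norm_num
    _ ≤ _ := add_le_add A B

lemma intervalIntegrable_of_bv {h : ℝ → ℝ} (h1 : ∀ t, h t = 1 ∨ h t = -1)
    (hbv : ∀ b₁ b₂ : ℝ, eVariationOn h (Set.Icc b₁ b₂) < ∞) (x y : ℝ) :
    IntervalIntegrable h volume x y := by
  have hl : LocallyBoundedVariationOn h Set.univ := fun b₁ b₂ _ _ => by
    rw [Set.univ_inter]; exact (hbv b₁ b₂).ne
  obtain ⟨p, q, hp, hq, rfl⟩ := hl.exists_monotoneOn_sub_monotoneOn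
  rw [intervalIntegrable_iff]
  have hm : Measurable (p - q) :=
    (monotoneOn_univ.1 hp).measurable.sub (monotoneOn_univ.1 hq).measurable
  refine Measure.integrableOn_of_bounded (M := 1) ?_ hm.aestronglyMeasurable ?_
  · simp
  · refine Eventually.of_forall fun t => ?_
    rcases h1 t with h | h <;> simp only [h] <;> norm_num

lemma sawtoothLoc_primitive {h : ℝ → ℝ} (h1 : ∀ t, h t = 1 ∨ h t = -1)
    (hbv : ∀ b₁ b₂ : ℝ, eVariationOn h (Set.Icc b₁ b₂) < ∞) (c x₀ : ℝ) :
    SawtoothLoc (fun x => c + ∫ t in x₀..x, h t) h := by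
  refine ⟨h1, fun x y => ?_, hbv⟩
  have := intervalIntegral.integral_add_adjacent_intervals
    (intervalIntegrable_of_bv h1 hbv x₀ x) (intervalIntegrable_of_bv h1 hbv x y)
  simp only [← this]
  ring

namespace SawtoothLoc

variable {u g v h : ℝ → ℝ}

lemma abs_sub_le (H : SawtoothLoc u g) (x y : ℝ) : |u y - u x| ≤ |y - x| := by
  rw [H.2.1 x y, add_sub_cancel_left]
  have := intervalIntegral.norm_integral_le_of_norm_le_const (C := 1) (f := g) (a := x) (b := y)
    (fun t _ => by rcases H.1 t with h | h <;> rw [h] <;> norm_num)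
  simpa using this

lemma continuous (H : SawtoothLoc u g) : Continuous u := by
  have : LipschitzWith 1 u := LipschitzWith.of_dist_le_mul fun x y => by
    simpa [Real.dist_eq] using H.abs_sub_le y x
  exact this.continuous

lemma neg (H : SawtoothLoc u g) : SawtoothLoc (fun x => -u x) (fun x => -g x) := by
  refine ⟨fun t => ?_, fun x y => ?_, fun x y => ?_⟩
  · rcases H.1 t with h | h <;> simp [h]
  · simp only [intervalIntegral.integral_neg, H.2.1 x y, neg_add]
  · rw [eVariationOn_neg]; exact H.2.2 x y

lemma sub_eq_of_eqOn_const (H : SawtoothLoc u g) {x y c : ℝ} (hxy : x ≤ y)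
    (hg : ∀ t ∈ Set.Ioo x y, g t = c) : u y - u x = c * (y - x) := by
  rw [H.2.1 x y, add_sub_cancel_left, intervalIntegral.integral_of_le hxy,
    integral_Ioc_eq_integral_Ioo, setIntegral_congr_fun measurableSet_Ioo hg]
  simp [hxy, mul_comm]

lemma sub_eq_mul_sub (H : SawtoothLoc u g) (H' : SawtoothLoc v h) {x y c : ℝ} (hxy : x ≤ y)
    (hg : ∀ t ∈ Set.Ioo x y, h t = c * g t) : v y - v x = c * (u y - u x) := by
  rw [H.2.1 x y, H'.2.1 x y, add_sub_cancel_left, add_sub_cancel_left,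
    intervalIntegral.integral_of_le hxy, intervalIntegral.integral_of_le hxy,
    integral_Ioc_eq_integral_Ioo, setIntegral_congr_fun measurableSet_Ioo hg,
    integral_const_mul, integral_Ioc_eq_integral_Ioo]

/-- Near a point where `u` is not differentiable, `g` takes both signs. -/
lemma exists_sign_change (H : SawtoothLoc u g) {s x y : ℝ} (hx : x < s) (hy : s < y)
    (hs : ¬DifferentiableAt ℝ u s) : ∃ y₁ y₂, x < y₁ ∧ y₁ < y₂ ∧ y₂ < y ∧ g y₂ = -g y₁ := by
  by_contra! hc
  have key : ∀ t ∈ Set.Ioo x y, g t = g s := by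
    intro t ht
    rcases lt_trichotomy t s with h | rfl | h
    · have := hc t s ht.1 h hy
      rcases H.1 t with h1 | h1 <;> rcases H.1 s with h2 | h2 <;> simp_all
    · rfl
    · have := hc s t hx h ht.2
      rcases H.1 t with h1 | h1 <;> rcases H.1 s with h2 | h2 <;> simp_all
  apply hs
  have : u =ᶠ[𝓝 s] fun t => u s + g s * (t - s) := by
    filter_upwards [Ioo_mem_nhds hx hy] with t ht
    rcases le_total t s with h | h
    · have := H.sub_eq_of_eqOn_const (c := g s) h
        fun r hr => key r ⟨ht.1.trans hr.1, hr.2.trans hy⟩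
      linarith
    · have := H.sub_eq_of_eqOn_const (c := g s) h
        fun r hr => key r ⟨hx.trans hr.1, hr.2.trans ht.2⟩
      linarith
  rw [this.differentiableAt_iff]
  fun_prop

end SawtoothLoc

/-- The interface energy `f^ω_{R,m}` without the normalising factor `1 / R`. -/
def interfaceEnergy (A₀ : ℝ) (a : ℝ → ℝ) (R mval : ℝ) (u g : ℝ → ℝ) : ℝ≥0∞ :=
  ENNReal.ofReal A₀ * eVariationOn g (Set.Ioo (-(R / 2)) (R / 2)) +
    ENNReal.ofReal mval *
      ∫⁻ t in Set.Ioo (-(R / 2)) (R / 2), ENNReal.ofReal (a t * u t ^ 2)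

/-- `(u, g)` is a sawtooth function that minimizes the interface energy. -/
def IsInterfaceMinimizer (A₀ : ℝ) (a : ℝ → ℝ) (R mval : ℝ) (u g : ℝ → ℝ) : Prop :=
  SawtoothLoc u g ∧ ∀ v h : ℝ → ℝ, SawtoothLoc v h →
    interfaceEnergy A₀ a R mval u g ≤ interfaceEnergy A₀ a R mval v h

lemma interfaceEnergy_le_of_fRm_le {A₀ R mval : ℝ} {a u g v h : ℝ → ℝ} (hR : 1 < R)
    (H : fRm A₀ a R mval u g ≤ fRm A₀ a R mval v h) :
    interfaceEnergy A₀ a R mval u g ≤ interfaceEnergy A₀ a R mval v h := by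
  have h0 : ENNReal.ofReal R⁻¹ ≠ 0 := by
    rw [Ne, ENNReal.ofReal_eq_zero, not_le]; positivity
  exact (ENNReal.mul_le_mul_iff_right h0 ENNReal.ofReal_ne_top).1 H

lemma interfaceEnergy_neg (A₀ : ℝ) (a : ℝ → ℝ) (R mval : ℝ) (u g : ℝ → ℝ) :
    interfaceEnergy A₀ a R mval (fun x => -u x) (fun x => -g x) =
      interfaceEnergy A₀ a R mval u g := by
  simp only [interfaceEnergy, eVariationOn_neg, neg_sq]

lemma IsInterfaceMinimizer.neg {A₀ R mval : ℝ} {a u g : ℝ → ℝ}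
    (H : IsInterfaceMinimizer A₀ a R mval u g) :
    IsInterfaceMinimizer A₀ a R mval (fun x => -u x) (fun x => -g x) :=
  ⟨H.1.neg, fun v h hv => by rw [interfaceEnergy_neg]; exact H.2 v h hv⟩

lemma setLIntegral_ofReal_mul_sq_lt_top {a u : ℝ → ℝ} (ha : ∀ t, 1 ≤ a t ∧ a t ≤ 2)
    (hu : Continuous u) (x y : ℝ) :
    ∫⁻ t in Set.Ioo x y, ENNReal.ofReal (a t * u t ^ 2) < ∞ := by
  obtain ⟨C, hC⟩ := isCompact_Icc.exists_bound_of_continuousOn (s := Set.Icc x y) hu.continuousOn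
  calc ∫⁻ t in Set.Ioo x y, ENNReal.ofReal (a t * u t ^ 2)
      ≤ ∫⁻ _ in Set.Ioo x y, ENNReal.ofReal (2 * C ^ 2) := by
        refine setLIntegral_mono' measurableSet_Ioo fun t ht => ENNReal.ofReal_le_ofReal ?_
        have h1 := hC t ⟨ht.1.le, ht.2.le⟩
        have h2 : u t ^ 2 ≤ C ^ 2 := by
          rw [← sq_abs (u t), ← Real.norm_eq_abs]
          exact pow_le_pow_left₀ (norm_nonneg _) h1 2
        have := (ha t).2
        nlinarith [sq_nonneg (u t)]
    _ < ∞ := by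
        rw [setLIntegral_const, Real.volume_Ioo]
        exact ENNReal.mul_lt_top ENNReal.ofReal_lt_top ENNReal.ofReal_lt_top

lemma Continuous.exists_first_exit_right {f : ℝ → ℝ} (hf : Continuous f) {k x₀ b : ℝ}
    (hx : k < f x₀) (hb : x₀ ≤ b) :
    ∃ q, x₀ ≤ q ∧ q ≤ b ∧ (∀ y, x₀ ≤ y → y < q → k < f y) ∧ (f q = k ∨ q = b) := by
  by_cases hall : ∀ y ∈ Set.Icc x₀ b, k < f y
  · exact ⟨b, hb, le_rfl, fun y h1 h2 => hall y ⟨h1, h2.le⟩, Or.inr rfl⟩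
  · push Not at hall
    have hc : IsCompact (Set.Icc x₀ b ∩ {y | f y ≤ k}) :=
      isCompact_Icc.inter_right (isClosed_le hf continuous_const)
    obtain ⟨z, ⟨hz, hzk⟩, hmin⟩ := hc.exists_isLeast hall
    refine ⟨z, hz.1, hz.2, fun y h1 h2 => ?_, Or.inl ?_⟩
    · by_contra! h3
      exact absurd (hmin ⟨⟨h1, h2.le.trans hz.2⟩, h3⟩) (not_le.2 h2)
    · obtain ⟨y, hy, hyk⟩ := intermediate_value_Icc' hz.1 hf.continuousOn ⟨hzk, hx.le⟩
      rw [← le_antisymm hy.2 (hmin ⟨⟨hy.1, hy.2.trans hz.2⟩, hyk.le⟩), hyk]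

lemma Continuous.exists_first_exit_left {f : ℝ → ℝ} (hf : Continuous f) {k x₀ b : ℝ}
    (hx : k < f x₀) (hb : b ≤ x₀) :
    ∃ p, p ≤ x₀ ∧ b ≤ p ∧ (∀ y, y ≤ x₀ → p < y → k < f y) ∧ (f p = k ∨ p = b) := by
  obtain ⟨q, h1, h2, h3, h4⟩ := (hf.comp continuous_neg).exists_first_exit_right
    (x₀ := -x₀) (b := -b) (k := k) (by simpa using hx) (by linarith)
  refine ⟨-q, by linarith, by linarith, fun y hy hq => ?_, h4.imp id fun h => by linarith⟩
  simpa using h3 (-y) (by linarith) (by linarith)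

/-- Reflecting a sawtooth function at the level `k` on an interval `[p, q]` gives a sawtooth
function, provided `u = k` at those endpoints that are interior to the domain. -/
lemma SawtoothLoc.exists_reflection {u g : ℝ → ℝ} (H : SawtoothLoc u g) {k p q A B : ℝ}
    (hpq : p < q) (hp : u p = k ∨ p = A) (hq : u q = k ∨ q = B) :
    ∃ v h : ℝ → ℝ, SawtoothLoc v h ∧ (∀ s, eVariationOn h s ≤ eVariationOn g s + 4) ∧
      (∀ x, p ≤ x → x ≤ q → v x = 2 * k - u x) ∧
      (∀ x, A < x → x < p → v x = u x) ∧ (∀ x, q < x → x < B → v x = u x) := by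
  set w₁ : ℝ → ℝ := fun x => if p < x then -1 else 1 with hw₁
  set w₂ : ℝ → ℝ := fun x => if x < q then 1 else -1 with hw₂
  have e₁ : ∀ x, w₁ x = 1 ∨ w₁ x = -1 := fun x => by simp only [hw₁]; split_ifs <;> simp
  have e₂ : ∀ x, w₂ x = 1 ∨ w₂ x = -1 := fun x => by simp only [hw₂]; split_ifs <;> simp
  have a₁ : Antitone w₁ := fun x y hxy => by
    simp only [hw₁]; split_ifs <;> linarith
  have a₂ : Antitone w₂ := fun x y hxy => by
    simp only [hw₂]; split_ifs <;> linarith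
  have e₃ : ∀ x, w₂ x * g x = 1 ∨ w₂ x * g x = -1 := fun x => by
    rcases e₂ x with h | h <;> rcases H.1 x with h' | h' <;> simp [h, h']
  have e₄ : ∀ x, w₁ x * (w₂ x * g x) = 1 ∨ w₁ x * (w₂ x * g x) = -1 := fun x => by
    rcases e₁ x with h | h <;> rcases e₃ x with h' | h' <;> simp [h, h']
  have nrm : ∀ {r : ℝ}, (r = 1 ∨ r = -1) → ‖r‖ₑ ≤ 1 := by
    rintro r (rfl | rfl) <;> simp
  have var : ∀ s, eVariationOn (fun x => w₁ x * (w₂ x * g x)) s ≤ eVariationOn g s + 4 := by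
    intro s
    have V₁ := (a₁.antitoneOn s).eVariationOn_le_two fun x _ => e₁ x
    have V₂ := (a₂.antitoneOn s).eVariationOn_le_two fun x _ => e₂ x
    have M₁ := eVariationOn_fun_mul_le (f := w₁) (g := fun x => w₂ x * g x) (s := s)
      (fun x _ => nrm (e₁ x)) (fun x _ => nrm (e₃ x))
    have M₂ := eVariationOn_fun_mul_le (f := w₂) (g := g) (s := s)
      (fun x _ => nrm (e₂ x)) (fun x _ => nrm (H.1 x))
    simp only [one_mul] at M₁ M₂
    calc _ ≤ _ := M₁
      _ ≤ (eVariationOn g s + 2) + 2 := by gcongr; exact M₂.trans (by gcongr)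
      _ = _ := by rw [add_assoc]; norm_num
  set h : ℝ → ℝ := fun x => w₁ x * (w₂ x * g x) with hh
  set v : ℝ → ℝ := fun x => (2 * k - u p) + ∫ t in p..x, h t with hv
  have S : SawtoothLoc v h := sawtoothLoc_primitive e₄
    (fun b₁ b₂ => (var _).trans_lt (ENNReal.add_lt_top.2 ⟨H.2.2 _ _, by simp⟩)) _ _
  have vp : v p = 2 * k - u p := by simp [hv]
  have mid : ∀ x, p ≤ x → x ≤ q → v x = 2 * k - u x := fun x h1 h2 => by
    have := H.sub_eq_mul_sub S (c := -1) h1 fun t ht => by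
      simp only [hh, hw₁, hw₂]
      rw [if_pos ht.1, if_pos (ht.2.trans_le h2)]; ring
    linarith
  refine ⟨v, h, S, var, mid, fun x h1 h2 => ?_, fun x h1 h2 => ?_⟩
  · have := H.sub_eq_mul_sub S (c := 1) h2.le fun t ht => by
      simp only [hh, hw₁, hw₂]
      rw [if_neg (not_lt.2 ht.2.le), if_pos (ht.2.trans hpq)]; ring
    rcases hp with hp | hp <;> linarith
  · have := H.sub_eq_mul_sub S (c := 1) h1.le fun t ht => by
      simp only [hh, hw₁, hw₂]
      rw [if_pos (hpq.trans ht.1), if_neg (not_lt.2 ht.1.le)]; ring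
    have := mid q hpq.le le_rfl
    rcases hq with hq | hq <;> linarith

namespace IsInterfaceMinimizer

variable {α A₀ R mval : ℝ} {a u g : ℝ → ℝ}

lemma le_bound (H : IsInterfaceMinimizer A₀ a R mval u g) (ha : ∀ t, 1 ≤ a t ∧ a t ≤ 2)
    (hR : 1 < R) (hα : 0 < α) (hA₀ : 0 < A₀) (hm : α ≤ mval) {x₀ : ℝ}
    (hx₀ : x₀ ∈ Set.Icc (-(R / 2)) (R / 2)) : u x₀ ≤ 16 * A₀ / α + 1 := by
  by_contra! hB
  have hA : 0 < 16 * A₀ / α := by positivity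
  obtain ⟨k, hk⟩ : ∃ k, k = u x₀ - 1 / 2 := ⟨_, rfl⟩
  have hk0 : 0 < k := by linarith
  have hkx : k < u x₀ := by linarith
  obtain ⟨q, q1, q2, q3, q4⟩ := H.1.continuous.exists_first_exit_right hkx hx₀.2
  obtain ⟨p, p1, p2, p3, p4⟩ := H.1.continuous.exists_first_exit_left hkx hx₀.1
  have hqd : x₀ + 1 / 2 ≤ q ∨ q = R / 2 := q4.imp_left fun h => by
    have := abs_le.1 (H.1.abs_sub_le x₀ q)
    rw [abs_of_nonneg (sub_nonneg.2 q1)] at this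
    linarith
  have hpd : p ≤ x₀ - 1 / 2 ∨ p = -(R / 2) := p4.imp_left fun h => by
    have := abs_le.1 (H.1.abs_sub_le p x₀)
    rw [abs_of_nonneg (sub_nonneg.2 p1)] at this
    linarith
  have hpq : p < q := by
    rcases hqd with h | h <;> rcases hpd with h' | h' <;> linarith
  obtain ⟨v, h, S, var, mid, left, right⟩ := H.1.exists_reflection hpq p4 q4
  obtain ⟨y, hyx, hyx', hpy, hyq⟩ : ∃ y, x₀ - 1 / 4 ≤ y ∧ y ≤ x₀ ∧ p ≤ y ∧ y + 1 / 4 ≤ q := by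
    rcases le_total x₀ 0 with h0 | h0
    · exact ⟨x₀, by linarith, le_rfl, p1, by rcases hqd with h | h <;> linarith⟩
    · exact ⟨x₀ - 1 / 4, le_rfl, by linarith, by rcases hpd with h | h <;> linarith, by linarith⟩
  have gt_k : ∀ t, p < t → t < q → k < u t := fun t h1 h2 =>
    (le_total x₀ t).elim (fun h => q3 t h h2) fun h => p3 t h h1
  have key : ∀ t ∈ Set.Ioo (-(R / 2)) (R / 2), ENNReal.ofReal (a t * v t ^ 2) +
      (Set.Ioo y (y + 1 / 4)).indicator (fun _ => ENNReal.ofReal k) t ≤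
        ENNReal.ofReal (a t * u t ^ 2) := by
    intro t ht
    by_cases hJ : t ∈ Set.Ioo y (y + 1 / 4)
    · rw [Set.indicator_of_mem hJ, ← ENNReal.ofReal_add
        (mul_nonneg (by linarith [(ha t).1]) (sq_nonneg _)) hk0.le]
      apply ENNReal.ofReal_le_ofReal
      rw [mid t (by linarith [hJ.1]) (by linarith [hJ.2])]
      have h1 := abs_le.1 (H.1.abs_sub_le x₀ t)
      have h2 : |t - x₀| ≤ 1 / 4 := abs_le.2 ⟨by linarith [hJ.1], by linarith [hJ.2]⟩
      have h3 : k + 1 / 4 ≤ u t := by linarith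
      have h4 := (ha t).1
      have h5 : 1 ≤ 4 * (u t - k) := by linarith
      have h6 : k * 1 ≤ k * (4 * (u t - k)) := by gcongr
      have h7 : 1 * (k * (4 * (u t - k))) ≤ a t * (k * (4 * (u t - k))) := by
        gcongr
      nlinarith
    · rw [Set.indicator_of_notMem hJ, add_zero]
      apply ENNReal.ofReal_le_ofReal
      have h4 := (ha t).1
      rcases lt_or_ge t p with h1 | h1
      · rw [left t ht.1 h1]
      rcases lt_or_ge q t with h2 | h2
      · rw [right t h2 ht.2]
      rw [mid t h1 h2]
      have h3 : k ≤ u t := by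
        have hcl : t ∈ closure (Set.Ioo p q) := by
          rw [closure_Ioo hpq.ne]; exact ⟨h1, h2⟩
        exact closure_minimal (fun z hz => (gt_k z hz.1 hz.2).le)
          (isClosed_le continuous_const H.1.continuous) hcl
      have h7 : 0 ≤ a t * (k * (4 * (u t - k))) := by
        have := sub_nonneg.2 h3
        positivity
      nlinarith
  have hsub : Set.Ioo y (y + 1 / 4) ⊆ Set.Ioo (-(R / 2)) (R / 2) :=
    Set.Ioo_subset_Ioo (by linarith) (by linarith)
  have int := setLIntegral_mono' (μ := volume) measurableSet_Ioo key
  rw [lintegral_add_right _ (measurable_const.indicator measurableSet_Ioo),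
    lintegral_indicator measurableSet_Ioo, Measure.restrict_restrict measurableSet_Ioo,
    Set.inter_eq_left.2 hsub, setLIntegral_const, Real.volume_Ioo, add_sub_cancel_left] at int
  have E := H.2 v h S
  have hvar := var (Set.Ioo (-(R / 2)) (R / 2))
  have hgfin : eVariationOn g (Set.Ioo (-(R / 2)) (R / 2)) ≠ ∞ :=
    ((eVariationOn.mono g Set.Ioo_subset_Icc_self).trans_lt (H.1.2.2 _ _)).ne
  have hvfin := (setLIntegral_ofReal_mul_sq_lt_top ha S.continuous (-(R / 2)) (R / 2)).ne
  have hm0 : 0 < mval := hα.trans_le hm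
  rw [interfaceEnergy, interfaceEnergy] at E
  have E' := (add_le_add_right (mul_le_mul_right int (ENNReal.ofReal mval)) _).trans
    (E.trans (add_le_add_left (mul_le_mul_right hvar (ENNReal.ofReal A₀)) _))
  rw [mul_add, mul_add, add_right_comm, ← add_assoc] at E'
  rw [ENNReal.add_le_add_iff_left (ENNReal.add_ne_top.2
    ⟨ENNReal.mul_ne_top ENNReal.ofReal_ne_top hgfin,
      ENNReal.mul_ne_top ENNReal.ofReal_ne_top hvfin⟩), ← ENNReal.ofReal_mul hk0.le,
    ← ENNReal.ofReal_mul hm0.le, show (4 : ℝ≥0∞) = ENNReal.ofReal 4 by simp,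
    ← ENNReal.ofReal_mul hA₀.le, ENNReal.ofReal_le_ofReal_iff (by positivity)] at E'
  have h1 : α * k ≤ mval * k := by gcongr
  have h2 : k ≤ 16 * A₀ / α := by rw [le_div_iff₀ hα]; linarith
  linarith

/-- An upper bound on the gain in variation of any competitor that is uniformly close to the
minimizer and agrees with it outside of `[p, q]`. -/
lemma two_mul_le_of_competitor (H : IsInterfaceMinimizer A₀ a R mval u g)
    (ha : ∀ t, 1 ≤ a t ∧ a t ≤ 2) (hm : 0 < mval) (hA₀ : 0 < A₀) {v h : ℝ → ℝ}
    (S : SawtoothLoc v h)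
    (hvar : eVariationOn h (Set.Ioo (-(R / 2)) (R / 2)) + 2 ≤
      eVariationOn g (Set.Ioo (-(R / 2)) (R / 2)))
    {M D p q : ℝ} (hpq : p ≤ q) (hM0 : 0 ≤ M) (hD0 : 0 ≤ D)
    (hM : ∀ x ∈ Set.Ioo (-(R / 2)) (R / 2), |u x| ≤ M)
    (hD : ∀ x ∈ Set.Ioo (-(R / 2)) (R / 2), |v x - u x| ≤ D)
    (hoff : ∀ x ∈ Set.Ioo (-(R / 2)) (R / 2), x ∉ Set.Icc p q → v x = u x) :
    2 * A₀ ≤ mval * (2 * (D * (2 * M + D)) * (q - p)) := by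
  have hK : 0 ≤ 2 * (D * (2 * M + D)) := by positivity
  have key : ∀ t ∈ Set.Ioo (-(R / 2)) (R / 2), ENNReal.ofReal (a t * v t ^ 2) ≤
      ENNReal.ofReal (a t * u t ^ 2) +
        (Set.Icc p q).indicator (fun _ => ENNReal.ofReal (2 * (D * (2 * M + D)))) t := by
    intro t ht
    have h4 := ha t
    by_cases hJ : t ∈ Set.Icc p q
    · rw [Set.indicator_of_mem hJ, ← ENNReal.ofReal_add
        (mul_nonneg (by linarith) (sq_nonneg _)) hK]
      apply ENNReal.ofReal_le_ofReal
      have h1 : |v t + u t| ≤ 2 * M + D := by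
        have h1 := abs_le.1 (hM t ht)
        have h2 := abs_le.1 (hD t ht)
        exact abs_le.2 ⟨by linarith, by linarith⟩
      have h2 : (v t - u t) * (v t + u t) ≤ D * (2 * M + D) := by
        refine (le_abs_self _).trans ?_
        rw [abs_mul]
        exact mul_le_mul (hD t ht) h1 (abs_nonneg _) hD0
      have h3 : a t * ((v t - u t) * (v t + u t)) ≤ 2 * (D * (2 * M + D)) :=
        (mul_le_mul_of_nonneg_left h2 (by linarith)).trans
          (mul_le_mul_of_nonneg_right h4.2 (by positivity))
      nlinarith
    · rw [Set.indicator_of_notMem hJ, add_zero, hoff t ht hJ]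
  have int := setLIntegral_mono' (μ := volume) measurableSet_Ioo key
  rw [lintegral_add_right _ (measurable_const.indicator measurableSet_Icc),
    lintegral_indicator measurableSet_Icc, Measure.restrict_restrict measurableSet_Icc,
    setLIntegral_const] at int
  have int' := int.trans (add_le_add_right (mul_le_mul_right
    ((measure_mono Set.inter_subset_left).trans_eq Real.volume_Icc) _) _)
  have E := H.2 v h S
  have hhfin : eVariationOn h (Set.Ioo (-(R / 2)) (R / 2)) ≠ ∞ :=
    ((eVariationOn.mono h Set.Ioo_subset_Icc_self).trans_lt (S.2.2 _ _)).ne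
  have hufin := (setLIntegral_ofReal_mul_sq_lt_top ha H.1.continuous (-(R / 2)) (R / 2)).ne
  rw [interfaceEnergy, interfaceEnergy] at E
  have E' := (add_le_add_left (mul_le_mul_right hvar (ENNReal.ofReal A₀)) _).trans
    (E.trans (add_le_add_right (mul_le_mul_right int' (ENNReal.ofReal mval)) _))
  rw [mul_add, mul_add, add_right_comm, ← add_assoc] at E'
  rwa [ENNReal.add_le_add_iff_left (ENNReal.add_ne_top.2
    ⟨ENNReal.mul_ne_top ENNReal.ofReal_ne_top hhfin,
      ENNReal.mul_ne_top ENNReal.ofReal_ne_top hufin⟩), ← ENNReal.ofReal_mul hK,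
    ← ENNReal.ofReal_mul hm.le, show (2 : ℝ≥0∞) = ENNReal.ofReal 2 by simp,
    ← ENNReal.ofReal_mul hA₀.le,
    ENNReal.ofReal_le_ofReal_iff (mul_nonneg hm.le (mul_nonneg hK (sub_nonneg.2 hpq))),
    mul_comm A₀] at E'

end IsInterfaceMinimizer

lemma eVariationOn_cut_cut (f : ℝ → ℝ) {s : Set ℝ} {p q : ℝ} (hp : p ∈ s) (hq : q ∈ s)
    (hpq : p ≤ q) : eVariationOn f s = eVariationOn f (s ∩ Set.Iic p) +
      (eVariationOn f (s ∩ Set.Icc p q) + eVariationOn f (s ∩ Set.Ici q)) := by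
  rw [eVariationOn_cut f hp, eVariationOn_cut f (s := s ∩ Set.Ici p) ⟨hq, hpq⟩,
    Set.inter_assoc, Set.inter_assoc, Set.Ici_inter_Iic, Set.Ici_inter_Ici, sup_eq_right.2 hpq]

/-- Between two points where `g` has opposite signs, a sawtooth function can be replaced by one
whose derivative has a single jump. -/
lemma SawtoothLoc.exists_single_jump {u g : ℝ → ℝ} (H : SawtoothLoc u g) {σ p q : ℝ}
    (hσ : σ = 1 ∨ σ = -1) (hpq : p < q) (gp : g p = σ) (gq : g q = -σ) :
    ∃ v h : ℝ → ℝ, SawtoothLoc v h ∧ (∀ s, p ∈ s → q ∈ s → eVariationOn h s ≤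
        eVariationOn g (s ∩ Set.Iic p) + (2 + eVariationOn g (s ∩ Set.Ici q))) ∧
      (∀ x ≤ p, v x = u x) ∧ (∀ x, q ≤ x → v x = u x) := by
  obtain ⟨c, hc⟩ : ∃ c, c = (p + q) / 2 + σ * (u q - u p) / 2 := ⟨_, rfl⟩
  have hlip := abs_le.1 (H.abs_sub_le p q)
  rw [abs_of_pos (sub_pos.2 hpq)] at hlip
  have hpc : p ≤ c := by rcases hσ with rfl | rfl <;> linarith
  have hcq : c ≤ q := by rcases hσ with rfl | rfl <;> linarith
  set h : ℝ → ℝ := fun x =>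
    if x ≤ p then g x else if x < c then σ else if x < q then -σ else g x with hh
  have h1 : ∀ x, h x = 1 ∨ h x = -1 := fun x => by
    have := H.1 x
    simp only [hh]
    split_ifs <;> rcases hσ with rfl | rfl <;> simp_all
  have hleft : ∀ x ≤ p, h x = g x := fun x hx => by simp only [hh]; rw [if_pos hx]
  have hright : ∀ x, q ≤ x → h x = g x := fun x hx => by
    simp only [hh]
    rw [if_neg (by linarith), if_neg (by linarith), if_neg (by linarith)]
  have hmid : ∀ x ∈ Set.Icc p q, h x = if x ≤ p ∨ x < c then σ else -σ := by
    intro x hx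
    simp only [hh]
    grind
  have hvar2 : ∀ s : Set ℝ, eVariationOn h (s ∩ Set.Icc p q) ≤ 2 := by
    intro s
    rcases hσ with rfl | rfl
    · refine AntitoneOn.eVariationOn_le_two (fun x hx y hy hxy => ?_) fun x _ => h1 x
      rw [hmid x hx.2, hmid y hy.2]
      grind
    · refine MonotoneOn.eVariationOn_le_two (fun x hx y hy hxy => ?_) fun x _ => h1 x
      rw [hmid x hx.2, hmid y hy.2]
      grind
  have hvar : ∀ s, p ∈ s → q ∈ s → eVariationOn h s ≤
      eVariationOn g (s ∩ Set.Iic p) + (2 + eVariationOn g (s ∩ Set.Ici q)) := by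
    intro s hp hq
    rw [eVariationOn_cut_cut h hp hq hpq.le,
      eVariationOn.congr (s := s ∩ Set.Iic p) fun x hx => hleft x hx.2,
      eVariationOn.congr (s := s ∩ Set.Ici q) fun x hx => hright x hx.2]
    gcongr
    exact hvar2 s
  have hbv : ∀ b₁ b₂ : ℝ, eVariationOn h (Set.Icc b₁ b₂) < ∞ := by
    intro b₁ b₂
    have fin : ∀ t, eVariationOn g (Set.Icc (min b₁ p) (max b₂ q) ∩ t) < ∞ := fun t =>
      (eVariationOn.mono g Set.inter_subset_left).trans_lt (H.2.2 _ _)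
    calc _ ≤ eVariationOn h (Set.Icc (min b₁ p) (max b₂ q)) :=
          eVariationOn.mono h (Set.Icc_subset_Icc (min_le_left _ _) (le_max_left _ _))
      _ ≤ _ := hvar _ ⟨min_le_right _ _, hpq.le.trans (le_max_right _ _)⟩
          ⟨(min_le_right _ _).trans hpq.le, le_max_right _ _⟩
      _ < ∞ := ENNReal.add_lt_top.2 ⟨fin _, ENNReal.add_lt_top.2 ⟨by simp, fin _⟩⟩
  set v : ℝ → ℝ := fun x => u p + ∫ t in p..x, h t with hv
  have S : SawtoothLoc v h := sawtoothLoc_primitive h1 hbv _ _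
  have vp : v p = u p := by simp [hv]
  have vq : v q = u q := by
    have e1 := S.sub_eq_of_eqOn_const (c := σ) hpc fun t ht => by
      rw [hmid t ⟨ht.1.le, ht.2.le.trans hcq⟩, if_pos (Or.inr ht.2)]
    have e2 := S.sub_eq_of_eqOn_const (c := -σ) hcq fun t ht => by
      rw [hmid t ⟨hpc.trans ht.1.le, ht.2.le⟩, if_neg]
      rintro (h | h) <;> linarith [ht.1]
    rcases hσ with rfl | rfl <;> linarith
  refine ⟨v, h, S, hvar, fun x hx => ?_, fun x hx => ?_⟩
  · have := H.sub_eq_mul_sub S (c := 1) hx fun t ht => by rw [hleft t ht.2.le, one_mul]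
    linarith
  · have := H.sub_eq_mul_sub S (c := 1) hx fun t ht => by rw [hright t ht.1.le, one_mul]
    linarith

/-- A sawtooth function can be replaced by an affine one to the right of a given point. -/
lemma SawtoothLoc.exists_affine_tail {u g : ℝ → ℝ} (H : SawtoothLoc u g) (p : ℝ) :
    ∃ v h : ℝ → ℝ, SawtoothLoc v h ∧
      (∀ s, p ∈ s → eVariationOn h s ≤ eVariationOn g (s ∩ Set.Iic p)) ∧
      (∀ x ≤ p, v x = u x) ∧ (∀ x, p ≤ x → v x = u p + g p * (x - p)) := by
  set h : ℝ → ℝ := fun x => if x ≤ p then g x else g p with hh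
  have h1 : ∀ x, h x = 1 ∨ h x = -1 := fun x => by
    simp only [hh]
    split_ifs
    exacts [H.1 x, H.1 p]
  have hleft : ∀ x ≤ p, h x = g x := fun x hx => if_pos hx
  have hright : ∀ x, p ≤ x → h x = g p := fun x hx => by
    simp only [hh]
    split_ifs with h'
    exacts [by rw [le_antisymm h' hx], rfl]
  have hvar : ∀ s, p ∈ s → eVariationOn h s ≤ eVariationOn g (s ∩ Set.Iic p) := by
    intro s hp
    rw [eVariationOn_cut h hp,
      eVariationOn.congr (s := s ∩ Set.Iic p) fun x hx => hleft x hx.2,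
      eVariationOn.constant_on (f := h) (s := s ∩ Set.Ici p), add_zero]
    rintro _ ⟨x, hx, rfl⟩ _ ⟨y, hy, rfl⟩
    rw [hright x hx.2, hright y hy.2]
  have hbv : ∀ b₁ b₂ : ℝ, eVariationOn h (Set.Icc b₁ b₂) < ∞ := by
    intro b₁ b₂
    calc _ ≤ eVariationOn h (Set.Icc (min b₁ p) (max b₂ p)) :=
          eVariationOn.mono h (Set.Icc_subset_Icc (min_le_left _ _) (le_max_left _ _))
      _ ≤ _ := hvar _ ⟨min_le_right _ _, le_max_right _ _⟩
      _ < ∞ := (eVariationOn.mono g Set.inter_subset_left).trans_lt (H.2.2 _ _)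
  set v : ℝ → ℝ := fun x => u p + ∫ t in p..x, h t with hv
  have S : SawtoothLoc v h := sawtoothLoc_primitive h1 hbv _ _
  have vp : v p = u p := by simp [hv]
  refine ⟨v, h, S, hvar, fun x hx => ?_, fun x hx => ?_⟩
  · have := H.sub_eq_mul_sub S (c := 1) hx fun t ht => by rw [hleft t ht.2.le, one_mul]
    linarith
  · have := S.sub_eq_of_eqOn_const (c := g p) hx fun t ht => hright t ht.1.le
    linarith

/-- Two sawtooth functions agreeing at a point stay close nearby. -/
lemma SawtoothLoc.abs_sub_le_of_eq {u g v h : ℝ → ℝ} (H : SawtoothLoc u g)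
    (S : SawtoothLoc v h) {p x δ : ℝ} (hp : v p = u p) (hδ : |x - p| ≤ δ) :
    |v x - u x| ≤ 2 * δ := by
  have h1 := abs_le.1 ((H.abs_sub_le p x).trans hδ)
  have h2 := abs_le.1 ((S.abs_sub_le p x).trans hδ)
  exact abs_le.2 ⟨by linarith, by linarith⟩

/-- The length of an interval on which a sawtooth function bounded by `M` is affine. -/
lemma SawtoothLoc.sub_le_of_eqOn_const {u g : ℝ → ℝ} (H : SawtoothLoc u g) {σ x y M : ℝ}
    (hσ : σ = 1 ∨ σ = -1) (hxy : x ≤ y) (hg : ∀ t ∈ Set.Ioo x y, g t = σ)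
    (hx : |u x| ≤ M) (hy : |u y| ≤ M) : y - x ≤ 2 * M := by
  have h1 := H.sub_eq_of_eqOn_const hxy hg
  have h2 := abs_le.1 hx
  have h3 := abs_le.1 hy
  rcases hσ with rfl | rfl <;> linarith

lemma IsInterfaceMinimizer.two_mul_le_of_sign_changes {A₀ R mval : ℝ} {a u g : ℝ → ℝ}
    (H : IsInterfaceMinimizer A₀ a R mval u g)
    (ha : ∀ t, 1 ≤ a t ∧ a t ≤ 2) (hm : 0 < mval) (hA₀ : 0 < A₀) {M η σ p x₁ x₂ : ℝ}
    (hM0 : 0 ≤ M) (hM : ∀ x ∈ Set.Icc (-(R / 2)) (R / 2), |u x| ≤ M) (hη : 0 < η)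
    (hσ : σ = 1 ∨ σ = -1) (hp : -(R / 2) < p) (hp₁ : p < x₁) (h₁₂ : x₁ < x₂)
    (h₂ : x₂ < R / 2) (hd : x₂ - p ≤ 2 * η) (gp : g p = σ) (g₁ : g x₁ = -σ) (g₂ : g x₂ = σ) :
    2 * A₀ ≤ mval * (2 * (4 * η * (2 * M + 4 * η)) * (2 * M + 3 * η)) := by
  suffices ∃ v h : ℝ → ℝ, ∃ q, SawtoothLoc v h ∧
      eVariationOn h (Set.Ioo (-(R / 2)) (R / 2)) + 2 ≤
        eVariationOn g (Set.Ioo (-(R / 2)) (R / 2)) ∧ p ≤ q ∧ q - p ≤ 2 * M + 3 * η ∧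
      (∀ x ∈ Set.Ioo (-(R / 2)) (R / 2), |v x - u x| ≤ 4 * η) ∧
      (∀ x ∈ Set.Ioo (-(R / 2)) (R / 2), x ∉ Set.Icc p q → v x = u x) by
    obtain ⟨v, h, q, S, hvar, hpq, hlen, hD, hoff⟩ := this
    refine (H.two_mul_le_of_competitor ha hm hA₀ S hvar hpq hM0 (by positivity)
      (fun x hx => hM x ⟨hx.1.le, hx.2.le⟩) hD hoff).trans ?_
    gcongr
  have hpI : p ∈ Set.Ioo (-(R / 2)) (R / 2) := ⟨hp, by linarith⟩
  have hnear : ∀ v h : ℝ → ℝ, SawtoothLoc v h → v p = u p → ∀ x, p ≤ x → x ≤ x₂ →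
      |v x - u x| ≤ 4 * η := by
    intro v h S hv x hx hx'
    have := H.1.abs_sub_le_of_eq S (δ := 2 * η) hv
      (by rw [abs_of_nonneg (sub_nonneg.2 hx)]; linarith)
    linarith
  by_cases hQ : ∃ q ∈ Set.Ioo x₂ (R / 2), g q = -σ
  · set Q : Set ℝ := {q | q ∈ Set.Ioo x₂ (R / 2) ∧ g q = -σ} with hQdef
    have hne : Q.Nonempty := hQ
    have hbdd : BddBelow Q := ⟨x₂, fun q hq => hq.1.1.le⟩
    obtain ⟨r, hr⟩ : ∃ r, r = sInf Q := ⟨_, rfl⟩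
    have hxr : x₂ ≤ r := hr ▸ le_csInf hne fun q hq => hq.1.1.le
    obtain ⟨q, hqQ, hqr⟩ := exists_lt_of_csInf_lt hne (show sInf Q < r + η by linarith)
    have hrq : r ≤ q := hr ▸ csInf_le hbdd hqQ
    obtain ⟨⟨hxq, hqR⟩, gq⟩ := hqQ
    have hgr : ∀ t ∈ Set.Ioo x₂ r, g t = σ := by
      intro t ht
      have hn : g t ≠ -σ := fun hg =>
        absurd (csInf_le hbdd (show t ∈ Q from ⟨⟨ht.1, by linarith [ht.2]⟩, hg⟩))
          (not_le.2 (hr ▸ ht.2))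
      rcases H.1.1 t with h | h <;> rcases hσ with rfl | rfl <;> simp_all
    have hpq : p < q := by linarith
    have hqI : q ∈ Set.Ioo (-(R / 2)) (R / 2) := ⟨by linarith, hqR⟩
    obtain ⟨v, h, S, hvar, hl, hrt⟩ := H.1.exists_single_jump hσ hpq gp gq
    have hlen := H.1.sub_le_of_eqOn_const hσ hxr hgr (hM x₂ ⟨by linarith, by linarith⟩)
      (hM r ⟨by linarith, by linarith⟩)
    refine ⟨v, h, q, S, ?_, hpq.le, by linarith, fun x hx => ?_, fun x hx hxn => ?_⟩
    · rw [eVariationOn_cut_cut g hpI hqI hpq.le]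
      refine (add_le_add_left (hvar _ hpI hqI) 2).trans ?_
      have hfour : 4 ≤ eVariationOn g (Set.Ioo (-(R / 2)) (R / 2) ∩ Set.Icc p q) :=
        four_le_eVariationOn hσ ⟨hpI, le_rfl, hpq.le⟩
          ⟨⟨by linarith, by linarith⟩, by linarith, by linarith⟩
          ⟨⟨by linarith, by linarith⟩, by linarith, by linarith⟩ hp₁.le h₁₂.le gp g₁ g₂
      calc _ = eVariationOn g (Set.Ioo (-(R / 2)) (R / 2) ∩ Set.Iic p) +
            ((2 + 2) + eVariationOn g (Set.Ioo (-(R / 2)) (R / 2) ∩ Set.Ici q)) := by ring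
        _ ≤ _ := by
          gcongr
          exact le_trans (by norm_num) hfour
    · have hclose : ∀ x, r ≤ x → x ≤ q → |v x - u x| ≤ 2 * η := fun x h1 h2 =>
        H.1.abs_sub_le_of_eq S (hrt q le_rfl) (by rw [abs_sub_comm, abs_of_nonneg] <;> linarith)
      rcases le_total x p with h1 | h1
      · rw [hl x h1, sub_self, abs_zero]; positivity
      rcases le_total x x₂ with h2 | h2
      · exact hnear v h S (hl p le_rfl) x h1 h2
      rcases le_total q x with h3 | h3
      · rw [hrt x h3, sub_self, abs_zero]; positivity
      rcases le_total r x with h4 | h4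
      · linarith [hclose x h4 h3]
      have e1 := H.1.sub_eq_of_eqOn_const h2 fun t ht => hgr t ⟨ht.1, ht.2.trans_le h4⟩
      have e2 := H.1.sub_eq_of_eqOn_const h4 fun t ht => hgr t ⟨h2.trans_lt ht.1, ht.2⟩
      have l1 := abs_le.1 (S.abs_sub_le x₂ x)
      have l2 := abs_le.1 (S.abs_sub_le x r)
      rw [abs_of_nonneg (sub_nonneg.2 h2)] at l1
      rw [abs_of_nonneg (sub_nonneg.2 h4)] at l2
      have b1 := abs_le.1 (hnear v h S (hl p le_rfl) x₂ (by linarith) le_rfl)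
      have b2 := abs_le.1 (hclose r le_rfl hrq)
      rw [abs_le]
      rcases hσ with rfl | rfl <;> constructor <;> linarith
    · rcases lt_or_ge x p with h1 | h1
      · exact hl x h1.le
      · exact hrt x (not_lt.1 fun h2 => hxn ⟨h1, h2.le⟩)
  · push Not at hQ
    have hgr : ∀ t ∈ Set.Ioo x₂ (R / 2), g t = σ := by
      intro t ht
      have hn := hQ t ht
      rcases H.1.1 t with h | h <;> rcases hσ with rfl | rfl <;> simp_all
    obtain ⟨v, h, S, hvar, hl, hrt⟩ := H.1.exists_affine_tail p
    have hlen := H.1.sub_le_of_eqOn_const hσ h₂.le hgr (hM x₂ ⟨by linarith, by linarith⟩)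
      (hM (R / 2) ⟨by linarith, by linarith⟩)
    refine ⟨v, h, R / 2, S, ?_, by linarith, by linarith, fun x hx => ?_, fun x hx hxn => ?_⟩
    · rw [eVariationOn_cut g hpI]
      have hfour : 4 ≤ eVariationOn g (Set.Ioo (-(R / 2)) (R / 2) ∩ Set.Ici p) :=
        four_le_eVariationOn hσ ⟨hpI, Set.mem_Ici.2 le_rfl⟩
          ⟨⟨by linarith, by linarith⟩, hp₁.le⟩
          ⟨⟨by linarith, by linarith⟩, (hp₁.trans h₁₂).le⟩ hp₁.le h₁₂.le gp g₁ g₂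
      exact add_le_add (hvar _ hpI) (le_trans (by norm_num) hfour)
    · rcases le_total x p with h1 | h1
      · rw [hl x h1, sub_self, abs_zero]; positivity
      rcases le_total x x₂ with h2 | h2
      · exact hnear v h S (hl p le_rfl) x h1 h2
      have e1 := H.1.sub_eq_of_eqOn_const h2 fun t ht => hgr t ⟨ht.1, ht.2.trans hx.2⟩
      have b1 := hnear v h S (hl p le_rfl) x₂ (by linarith) le_rfl
      rw [hrt x₂ (by linarith), gp] at b1
      rw [hrt x h1, gp]
      convert b1 using 2
      linarith
    · exact hl x (not_lt.1 fun h2 => hxn ⟨h2.le, hx.2.le⟩)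

/-- The jump points of the derivative of a minimizer of the sharp interface functional
`f^ω_{R,m}` over sawtooth functions are separated by a distance at least `η > 0`
depending only on `α`, `β` and `A₀` (and not on `R > 1`, on `m ∈ [α,β]`, or on the
weight `a`). Jump points of `u'` are the points where the sawtooth function `u` fails
to be differentiable. -/
theorem minimizer_jump_separation
    (α β A₀ : ℝ) (hα : 0 < α) (hαβ : α ≤ β) (hA₀ : 0 < A₀) :
    ∃ η > 0, ∀ a : ℝ → ℝ, Measurable a → (∀ t, 1 ≤ a t ∧ a t ≤ 2) →
      ∀ R : ℝ, 1 < R → ∀ mval : ℝ, α ≤ mval → mval ≤ β →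
        ∀ u g : ℝ → ℝ, SawtoothLoc u g →
          (∀ v h : ℝ → ℝ, SawtoothLoc v h → fRm A₀ a R mval u g ≤ fRm A₀ a R mval v h) →
          ∀ s ∈ Set.Ioo (-(R / 2)) (R / 2), ∀ t ∈ Set.Ioo (-(R / 2)) (R / 2),
            s ≠ t → ¬DifferentiableAt ℝ u s → ¬DifferentiableAt ℝ u t →
            η ≤ |s - t| := by
  obtain ⟨M, hMdef⟩ : ∃ M, M = 16 * A₀ / α + 1 := ⟨_, rfl⟩
  have hM0 : 0 ≤ M := by rw [hMdef]; positivity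
  have hβ : 0 < β := hα.trans_le hαβ
  obtain ⟨η, hη⟩ : ∃ η, η = A₀ / (8 * β * (2 * M + 4) ^ 2 + A₀) := ⟨_, rfl⟩
  have hη0 : 0 < η := by rw [hη]; positivity
  have hη1 : η ≤ 1 := by
    rw [hη, div_le_one (by positivity)]
    have : 0 ≤ 8 * β * (2 * M + 4) ^ 2 := by positivity
    linarith
  have hηeq : η * (8 * β * (2 * M + 4) ^ 2 + A₀) = A₀ := by
    rw [hη]; field_simp
  refine ⟨η, hη0, ?_⟩
  intro a _ ha R hR m hαm hmβ u g hug hmin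
  have H : IsInterfaceMinimizer A₀ a R m u g :=
    ⟨hug, fun v h hv => interfaceEnergy_le_of_fRm_le hR (hmin v h hv)⟩
  have hm : 0 < m := hα.trans_le hαm
  have hM : ∀ x ∈ Set.Icc (-(R / 2)) (R / 2), |u x| ≤ M := fun x hx => by
    rw [hMdef]
    exact abs_le'.2 ⟨H.le_bound ha hR hα hA₀ hαm hx, H.neg.le_bound ha hR hα hA₀ hαm hx⟩
  intro s hs t ht hst hus hut
  wlog hlt : s < t generalizing s t
  · rw [abs_sub_comm]
    exact this t ht s hs hst.symm hut hus (lt_of_le_of_ne (not_lt.1 hlt) hst.symm)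
  by_contra! hclose
  rw [abs_sub_comm, abs_of_pos (sub_pos.2 hlt)] at hclose
  obtain ⟨y₁, y₂, hy₁, hy₁₂, hy₂, hgy⟩ := hug.exists_sign_change
    (max_lt hs.1 (show s - η / 2 < s by linarith)) (show s < (s + t) / 2 by linarith) hus
  obtain ⟨z₁, z₂, hz₁, hz₁₂, hz₂, hgz⟩ := hug.exists_sign_change
    (show (s + t) / 2 < t by linarith) (lt_min ht.2 (show t < t + η / 2 by linarith)) hut
  rw [max_lt_iff] at hy₁
  rw [lt_min_iff] at hz₂
  obtain ⟨x, hx₁, hx₂, hgx⟩ : ∃ x, z₁ ≤ x ∧ x ≤ z₂ ∧ g x = g y₁ := by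
    by_cases h : g z₁ = g y₁
    · exact ⟨z₁, le_rfl, hz₁₂.le, h⟩
    · refine ⟨z₂, hz₁₂.le, le_rfl, ?_⟩
      rcases hug.1 z₁ with h1 | h1 <;> rcases hug.1 y₁ with h2 | h2 <;> simp_all
  have key := H.two_mul_le_of_sign_changes ha hm hA₀ hM0 hM hη0 (hug.1 y₁) hy₁.1 hy₁₂
    (show y₂ < x by linarith) (by linarith) (by linarith) rfl hgy hgx
  have bound : m * (2 * (4 * η * (2 * M + 4 * η)) * (2 * M + 3 * η)) ≤
      β * (2 * (4 * η * (2 * M + 4)) * (2 * M + 4)) := by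
    gcongr <;> linarith
  nlinarith [mul_pos hη0 hA₀]
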